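/- For n ≥ 3, the Möbius function of the lattice of almost-interval partitions satisfies μ([0_n, 1_n]) = -2 μ([0_{n-1}, 1_{n-1}]); consequently μ([0_n, 1_n]) = (-1)^{n-1} 2^{n-2} for n ≥ 2, giving the sequence 1, -1, 2, -4, 8, -16, .... -/

import Mathlib

attribute [local instance] Classical.propDecidable

instance {α : Type*} [Finite α] : Finite (Setoid α) :=
  Finite.of_injective (fun s : Setoid α => s.r)
    (fun a b h => Setoid.ext fun x y => by rw [show a.r = b.r from h])

noncomputable instance {α : Type*} [Finite α] : Fintype (Setoid α) :=
  Fintype.ofFinite _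

/-- A set partition of `{0,...,n-1}` (encoded as a `Setoid (Fin n)`) is an *interval
partition* iff each of its blocks consists of consecutive integers. -/
def IsIntervalSetoid {n : ℕ} (s : Setoid (Fin n)) : Prop :=
  ∀ a b c : Fin n, a ≤ b → b ≤ c → s.r a c → s.r a b

/-- A set partition is *non-crossing* iff there are no `a < b < c < d` with `a, c` in one
block and `b, d` in a different block. -/
def IsNoncrossing {n : ℕ} (s : Setoid (Fin n)) : Prop :=
  ∀ a b c d : Fin n, a < b → b < c → c < d → s.r a c → s.r b d → s.r a b

/-- A subset of `Fin n` is a *cyclic interval* iff it consists of cyclically consecutive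
residues mod `n`. -/
def IsCyclicInterval {n : ℕ} (B : Set (Fin n)) : Prop :=
  ∃ (b : Fin n) (k : ℕ), B = {x | ∃ i ≤ k, x = ((finRotate n) ^ i) b}

/-- A set partition of `Fin n` is a *cyclic-interval partition* iff all of its blocks are
cyclic intervals. -/
def IsCyclicIntervalSetoid {n : ℕ} (s : Setoid (Fin n)) : Prop :=
  ∀ a : Fin n, IsCyclicInterval {x | s.r a x}

/-- The singleton-insertion map `Ψ^n_r` : it inserts a singleton block at position `r`,
shifting the rest of the partition. -/
def insertSingleton {n : ℕ} (r : Fin (n + 1)) (s : Setoid (Fin n)) : Setoid (Fin (n + 1)) where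
  r a b := (a = r ∧ b = r) ∨ ∃ i j : Fin n, a = r.succAbove i ∧ b = r.succAbove j ∧ s.r i j
  iseqv := by
    constructor
    · intro a
      rcases eq_or_ne a r with h | h
      · exact Or.inl ⟨h, h⟩
      · obtain ⟨i, hi⟩ := Fin.exists_succAbove_eq h
        exact Or.inr ⟨i, i, hi.symm, hi.symm, s.refl i⟩
    · rintro a b (⟨h1, h2⟩ | ⟨i, j, h1, h2, h3⟩)
      · exact Or.inl ⟨h2, h1⟩
      · exact Or.inr ⟨j, i, h2, h1, s.symm h3⟩
    · rintro a b c (⟨h1, h2⟩ | ⟨i, j, h1, h2, h3⟩) (⟨g1, g2⟩ | ⟨k, l, g1, g2, g3⟩)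
      · exact Or.inl ⟨h1, g2⟩
      · exact absurd (g1.symm.trans h2) (Fin.succAbove_ne r k)
      · exact absurd (h2.symm.trans g1) (Fin.succAbove_ne r j)
      · have hjk : j = k := Fin.succAbove_right_injective (h2.symm.trans g1)
        exact Or.inr ⟨i, l, h1, g2, s.trans h3 (hjk ▸ g3)⟩

/-- The elements of `Fin n` that do NOT form singleton blocks of `s`. -/
noncomputable def nonSingletons {n : ℕ} (s : Setoid (Fin n)) : Finset (Fin n) :=
  Finset.univ.filter fun x => ∃ y, y ≠ x ∧ s.r x y

/-- `RS s` removes all singleton blocks of the partition `s` and relabels the remaining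
elements in an order-preserving way. -/
noncomputable def RS {n : ℕ} (s : Setoid (Fin n)) : Setoid (Fin (nonSingletons s).card) where
  r i j := s.r ((nonSingletons s).orderIsoOfFin rfl i).1 ((nonSingletons s).orderIsoOfFin rfl j).1
  iseqv := ⟨fun i => s.refl _, fun h => s.symm h, fun h h' => s.trans h h'⟩

/-- An *almost-interval* partition: non-crossing, and removing the singleton blocks yields
an interval partition. -/
def IsAlmostInterval {n : ℕ} (s : Setoid (Fin n)) : Prop :=
  IsNoncrossing s ∧ IsIntervalSetoid (RS s)

/-- A *cyclic almost-interval* partition: non-crossing, and removing the singleton blocks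
yields a cyclic-interval partition. -/
def IsAlmostCyclicInterval {n : ℕ} (s : Setoid (Fin n)) : Prop :=
  IsNoncrossing s ∧ IsCyclicIntervalSetoid (RS s)

/-- The number of crossings of a set partition: the number of quadruples `a < b < c < d`
with `a ~ c`, `b ~ d` lying in two different blocks. -/
noncomputable def crossNum {n : ℕ} (s : Setoid (Fin n)) : ℕ :=
  Finset.card (Finset.univ.filter fun p : Fin n × Fin n × Fin n × Fin n =>
    p.1 < p.2.1 ∧ p.2.1 < p.2.2.1 ∧ p.2.2.1 < p.2.2.2 ∧
      s.r p.1 p.2.2.1 ∧ s.r p.2.1 p.2.2.2 ∧ ¬ s.r p.1 p.2.1)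

/-- `{r}` is a singleton block of the partition `s`. -/
def IsSingletonBlock {n : ℕ} (r : Fin n) (s : Setoid (Fin n)) : Prop :=
  ∀ y, s.r r y → y = r

/-- The partition `{{1,2},{3},...,{n}}` (in `Fin n` indexing: block `{0,1}`, rest singletons). -/
def pairBlockFirst (n : ℕ) : Setoid (Fin n) where
  r x y := x = y ∨ ((x : ℕ) < 2 ∧ (y : ℕ) < 2)
  iseqv := by
    refine ⟨fun x => Or.inl rfl, ?_, ?_⟩
    · rintro x y (rfl | h)
      · exact Or.inl rfl
      · exact Or.inr ⟨h.2, h.1⟩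
    · rintro x y z (rfl | h) h'
      · exact h'
      · rcases h' with rfl | h'
        · exact Or.inr h
        · exact Or.inr ⟨h.1, h'.2⟩

/-- The partition of `Fin n` whose blocks are the singleton `{k}` and its complement. -/
def singletonAt {n : ℕ} (k : Fin n) : Setoid (Fin n) where
  r x y := x = y ∨ (x ≠ k ∧ y ≠ k)
  iseqv := by
    refine ⟨fun x => Or.inl rfl, ?_, ?_⟩
    · rintro x y (rfl | h)
      · exact Or.inl rfl
      · exact Or.inr ⟨h.2, h.1⟩
    · rintro x y z (rfl | h) h'
      · exact h'
      · rcases h' with rfl | h'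
        · exact Or.inr h
        · exact Or.inr ⟨h.1, h'.2⟩

/-- The order embedding `Fin (n - m) → Fin n` that skips the `m` positions `j, ..., j+m-1`. -/
def skipEmb {n : ℕ} (m j : ℕ) (h : j + m ≤ n) (i : Fin (n - m)) : Fin n :=
  ⟨if (i : ℕ) < j then (i : ℕ) else (i : ℕ) + m, by have := i.isLt; split <;> omega⟩

/-- Weisner-type vanishing: if `J x` is the join of `x` with a fixed element `a` and all the
sums of `f` over `{x | x ≤ y}` with `a ≤ y` vanish, then `f` sums to zero over each fibre of `J`
above `a`. -/
theorem sum_fiber_join_eq_zero {P : Type*} [PartialOrder P] [Fintype P] (f : P → ℤ) (J : P → P)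
    (a : P) (hJa : ∀ x, a ≤ J x) (hJ : ∀ x y, a ≤ y → (J x ≤ y ↔ x ≤ y))
    (hf : ∀ y, a ≤ y → ∑ x ∈ Finset.univ.filter (fun x => x ≤ y), f x = 0) (y : P) (hy : a ≤ y) :
    ∑ x ∈ Finset.univ.filter (fun x => J x = y), f x = 0 := by
  induction y using WellFoundedLT.induction with
  | ind y ih =>
    have h := hf y hy
    rw [← Finset.sum_fiberwise_of_maps_to (t := Finset.univ.filter (fun z => a ≤ z ∧ z ≤ y))
      (g := J) (fun x hx => by
        simp only [Finset.mem_filter, Finset.mem_univ, true_and] at hx ⊢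
        exact ⟨hJa x, (hJ x y hy).2 hx⟩),
      Finset.sum_eq_single_of_mem y (by simp [hy])] at h
    · rw [← h]
      refine Finset.sum_congr ?_ fun _ _ => rfl
      ext x
      simp only [Finset.mem_filter, Finset.mem_univ, true_and]
      exact ⟨fun hx => ⟨(hJ x y hy).1 hx.le, hx⟩, fun hx => hx.2⟩
    · intro z hz hne
      simp only [Finset.mem_filter, Finset.mem_univ, true_and] at hz
      rw [← ih z (lt_of_le_of_ne hz.2 hne) hz.1]
      refine Finset.sum_congr ?_ fun _ _ => rfl
      ext x
      simp only [Finset.mem_filter, Finset.mem_univ, true_and]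
      exact ⟨fun hx => hx.2, fun hx => ⟨((hJ x z hz.1).1 hx.le).trans hz.2, hx⟩⟩

/-- A function on a finite poset determined by its sums over principal lower sets is preserved
by order embeddings onto lower sets. -/
theorem eq_of_sum_le_eq {P Q : Type*} [PartialOrder P] [Fintype P] [PartialOrder Q] [Fintype Q]
    (φ : Q ↪o P) (hφ : ∀ x q, x ≤ φ q → ∃ q', φ q' = x) (f : P → ℤ) (g : Q → ℤ)
    (h : ∀ q, ∑ x ∈ Finset.univ.filter (fun x => x ≤ φ q), f x =
      ∑ x ∈ Finset.univ.filter (fun x => x ≤ q), g x) (q : Q) : f (φ q) = g q := by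
  have hmap : ∀ q, Finset.univ.filter (fun x => x ≤ φ q) =
      (Finset.univ.filter (fun x => x ≤ q)).map φ.toEmbedding := by
    intro q
    ext x
    simp only [Finset.mem_filter, Finset.mem_univ, true_and, Finset.mem_map,
      RelEmbedding.coe_toEmbedding]
    constructor
    · intro hx
      obtain ⟨q', rfl⟩ := hφ x q hx
      exact ⟨q', φ.le_iff_le.1 hx, rfl⟩
    · rintro ⟨q', hq', rfl⟩
      exact φ.le_iff_le.2 hq'
  induction q using WellFoundedLT.induction with
  | ind q ih =>
    have hq := h q
    rw [hmap, Finset.sum_map] at hq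
    have hmem : q ∈ Finset.univ.filter (fun x => x ≤ q) := by simp
    rw [← Finset.add_sum_erase _ _ hmem, ← Finset.add_sum_erase _ _ hmem] at hq
    have hrest : ∑ x ∈ (Finset.univ.filter (fun x => x ≤ q)).erase q, f (φ.toEmbedding x) =
        ∑ x ∈ (Finset.univ.filter (fun x => x ≤ q)).erase q, g x := by
      refine Finset.sum_congr rfl fun x hx => ?_
      simp only [Finset.mem_erase, Finset.mem_filter, Finset.mem_univ, true_and] at hx
      exact ih x (lt_of_le_of_ne hx.2 hx.1)
    rw [hrest] at hq
    exact add_right_cancel hq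

theorem isAlmostInterval_iff {n : ℕ} (s : Setoid (Fin n)) :
    IsAlmostInterval s ↔
      ∀ a b c : Fin n, a < b → b < c → s a c → (∃ y, y ≠ b ∧ s b y) → s a b := by
  constructor
  · rintro ⟨-, h⟩ a b c hab hbc hac hb
    have ha' : a ∈ nonSingletons s := by
      simp only [nonSingletons, Finset.mem_filter, Finset.mem_univ, true_and]
      exact ⟨c, (hab.trans hbc).ne', hac⟩
    have hb' : b ∈ nonSingletons s := by
      simp only [nonSingletons, Finset.mem_filter, Finset.mem_univ, true_and]
      exact hb
    have hc' : c ∈ nonSingletons s := by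
      simp only [nonSingletons, Finset.mem_filter, Finset.mem_univ, true_and]
      exact ⟨a, (hab.trans hbc).ne, s.symm hac⟩
    let e := (nonSingletons s).orderIsoOfFin rfl
    have key := h (e.symm ⟨a, ha'⟩) (e.symm ⟨b, hb'⟩) (e.symm ⟨c, hc'⟩)
      (e.symm.monotone hab.le) (e.symm.monotone hbc.le)
    have hRS : ∀ i j, RS s i j ↔ s (e i).1 (e j).1 := fun _ _ => Iff.rfl
    simp only [hRS, e.apply_symm_apply] at key
    exact key hac
  · intro h
    constructor
    · intro a b c d hab hbc hcd hac hbd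
      exact h a b c hab hbc hac ⟨d, (hbc.trans hcd).ne', hbd⟩
    · intro i j k hij hjk hik
      rcases hij.eq_or_lt with rfl | hij
      · exact (RS s).refl _
      rcases hjk.eq_or_lt with rfl | hjk
      · exact hik
      refine h _ _ _ (((nonSingletons s).orderIsoOfFin rfl).strictMono hij)
        (((nonSingletons s).orderIsoOfFin rfl).strictMono hjk) hik ?_
      have := ((nonSingletons s).orderIsoOfFin rfl j).2
      simpa only [nonSingletons, Finset.mem_filter, Finset.mem_univ, true_and] using this

theorem insertSingleton_succAbove {n : ℕ} (r : Fin (n + 1)) (s : Setoid (Fin n)) (i j : Fin n) :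
    insertSingleton r s (r.succAbove i) (r.succAbove j) ↔ s i j := by
  constructor
  · rintro (⟨h, -⟩ | ⟨i', j', hi, hj, h⟩)
    · exact absurd h (Fin.succAbove_ne r i)
    · rwa [Fin.succAbove_right_injective hi, Fin.succAbove_right_injective hj]
  · exact fun h => Or.inr ⟨i, j, rfl, rfl, h⟩

theorem insertSingleton_self {n : ℕ} (r : Fin (n + 1)) (s : Setoid (Fin n)) (y : Fin (n + 1)) :
    insertSingleton r s r y ↔ y = r := by
  constructor
  · rintro (⟨-, h⟩ | ⟨i', j', hi, -⟩)
    · exact h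
    · exact absurd hi.symm (Fin.succAbove_ne r i')
  · exact fun h => Or.inl ⟨rfl, h⟩

theorem insertSingleton_le_iff {n : ℕ} (r : Fin (n + 1)) (s t : Setoid (Fin n)) :
    insertSingleton r s ≤ insertSingleton r t ↔ s ≤ t := by
  constructor
  · intro h i j hij
    exact (insertSingleton_succAbove r t i j).1 (h ((insertSingleton_succAbove r s i j).2 hij))
  · rintro h a b (hab | ⟨i, j, hi, hj, hij⟩)
    · exact Or.inl hab
    · exact Or.inr ⟨i, j, hi, hj, h hij⟩

theorem IsAlmostInterval.insertSingleton {n : ℕ} (r : Fin (n + 1)) {s : Setoid (Fin n)}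
    (hs : IsAlmostInterval s) : IsAlmostInterval (insertSingleton r s) := by
  rw [isAlmostInterval_iff] at hs ⊢
  rintro a b c hab hbc (⟨rfl, rfl⟩ | ⟨i, k, rfl, rfl, hik⟩) ⟨y, hy, hby⟩
  · exact absurd (hab.trans hbc) (lt_irrefl _)
  · rcases hby with ⟨rfl, rfl⟩ | ⟨j, l, rfl, rfl, hjl⟩
    · exact absurd rfl hy
    · rw [insertSingleton_succAbove]
      exact hs i j k ((Fin.strictMono_succAbove r).lt_iff_lt.1 hab)
        ((Fin.strictMono_succAbove r).lt_iff_lt.1 hbc) hik ⟨l, fun h => hy (h ▸ rfl), hjl⟩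

theorem IsAlmostInterval.comap_succAbove {n : ℕ} (r : Fin (n + 1)) {s : Setoid (Fin (n + 1))}
    (hs : IsAlmostInterval s) : IsAlmostInterval (s.comap r.succAbove) := by
  rw [isAlmostInterval_iff] at hs ⊢
  rintro a b c hab hbc hac ⟨y, hy, hby⟩
  exact hs _ _ _ (Fin.strictMono_succAbove r hab) (Fin.strictMono_succAbove r hbc) hac
    ⟨r.succAbove y, fun h => hy (Fin.succAbove_right_injective h), hby⟩

theorem insertSingleton_comap_succAbove {n : ℕ} (r : Fin (n + 1)) {s : Setoid (Fin (n + 1))}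
    (hs : IsSingletonBlock r s) : insertSingleton r (s.comap r.succAbove) = s := by
  ext a b
  constructor
  · rintro (⟨rfl, rfl⟩ | ⟨i, j, rfl, rfl, h⟩)
    · exact s.refl _
    · exact h
  · intro h
    rcases eq_or_ne a r with rfl | ha
    · exact Or.inl ⟨rfl, hs b h⟩
    rcases eq_or_ne b r with rfl | hb
    · exact absurd (hs a (s.symm h)) ha
    obtain ⟨i, rfl⟩ := Fin.exists_succAbove_eq ha
    obtain ⟨j, rfl⟩ := Fin.exists_succAbove_eq hb
    exact Or.inr ⟨i, j, rfl, rfl, h⟩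

/-- Insertion of a singleton block, as an embedding of lattices of almost-interval partitions. -/
def insertSingletonEmbedding {n : ℕ} (r : Fin (n + 1)) :
    {s : Setoid (Fin n) // IsAlmostInterval s} ↪o
      {s : Setoid (Fin (n + 1)) // IsAlmostInterval s} :=
  OrderEmbedding.ofMapLEIff (fun s => ⟨insertSingleton r s.1, s.2.insertSingleton r⟩)
    fun s t => insertSingleton_le_iff r s.1 t.1

theorem exists_insertSingletonEmbedding_eq {n : ℕ} (r : Fin (n + 1))
    (x : {s : Setoid (Fin (n + 1)) // IsAlmostInterval s}) (hx : IsSingletonBlock r x.1) :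
    ∃ q, insertSingletonEmbedding r q = x :=
  ⟨⟨x.1.comap r.succAbove, x.2.comap_succAbove r⟩,
    Subtype.ext (insertSingleton_comap_succAbove r hx)⟩

theorem isSingletonBlock_of_le {n : ℕ} {r : Fin (n + 1)}
    {x : {s : Setoid (Fin (n + 1)) // IsAlmostInterval s}}
    {q : {s : Setoid (Fin n) // IsAlmostInterval s}} (h : x ≤ insertSingletonEmbedding r q) :
    IsSingletonBlock r x.1 :=
  fun y hy => (insertSingleton_self r q.1 y).1 (h hy)

/-- The partition obtained from `s` by merging the blocks of `0` and `1`. -/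
def mergeFirst {n : ℕ} (s : Setoid (Fin (n + 2))) : Setoid (Fin (n + 2)) where
  r u v := s u v ∨ (s u 0 ∨ s u 1) ∧ (s v 0 ∨ s v 1)
  iseqv := by
    refine ⟨fun u => Or.inl (s.refl u), ?_, ?_⟩
    · rintro u v (h | h)
      · exact Or.inl (s.symm h)
      · exact Or.inr h.symm
    · rintro u v w (h | h) (h' | h')
      · exact Or.inl (s.trans h h')
      · exact Or.inr ⟨h'.1.imp (s.trans h) (s.trans h), h'.2⟩
      · exact Or.inr ⟨h.1, h.2.imp (s.trans (s.symm h')) (s.trans (s.symm h'))⟩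
      · exact Or.inr ⟨h.1, h'.2⟩

theorem le_mergeFirst {n : ℕ} (s : Setoid (Fin (n + 2))) : s ≤ mergeFirst s :=
  fun _ _ h => Or.inl h

theorem mergeFirst_zero_one {n : ℕ} (s : Setoid (Fin (n + 2))) : mergeFirst s 0 1 :=
  Or.inr ⟨Or.inl (s.refl _), Or.inr (s.refl _)⟩

theorem mergeFirst_le {n : ℕ} {s t : Setoid (Fin (n + 2))} (hst : s ≤ t) (ht : t 0 1) :
    mergeFirst s ≤ t := by
  rintro u v (h | ⟨hu, hv⟩)
  · exact hst h
  · have key : ∀ w, s w 0 ∨ s w 1 → t w 0 := by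
      rintro w (h | h)
      · exact hst h
      · exact t.trans (hst h) (t.symm ht)
    exact t.trans (key u hu) (t.symm (key v hv))

theorem IsAlmostInterval.mergeFirst {n : ℕ} {s : Setoid (Fin (n + 2))} (hs : IsAlmostInterval s) :
    IsAlmostInterval (mergeFirst s) := by
  rw [isAlmostInterval_iff] at hs ⊢
  rintro a b c hab hbc hac ⟨y, hy, hby⟩
  have hb0 : 0 < b := (Fin.zero_le a).trans_lt hab
  by_cases hb : ∃ y, y ≠ b ∧ s b y
  · rcases hac with hac | ⟨ha, hc⟩
    · exact Or.inl (hs a b c hab hbc hac hb)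
    · refine Or.inr ⟨ha, ?_⟩
      rcases hc with hc | hc
      · exact Or.inl (s.symm (hs 0 b c hb0 hbc (s.symm hc) hb))
      · rcases (Fin.one_le_of_ne_zero hb0.ne').eq_or_lt with h1 | h1
        · exact Or.inr (h1 ▸ s.refl _)
        · exact Or.inr (s.symm (hs 1 b c h1 hbc (s.symm hc) hb))
  · have hb' : ∀ y, s b y → y = b := fun y h => by_contra fun hne => hb ⟨y, hne, h⟩
    rcases hby with hby | ⟨hb1, -⟩
    · exact absurd (hb' y hby) hy
    · have hb1 : b = 1 := by
        rcases hb1 with h | h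
        · exact absurd (hb' _ h) hb0.ne
        · exact (hb' _ h).symm
      subst hb1
      have ha : a = 0 := Fin.lt_one_iff _ |>.1 hab
      subst ha
      exact mergeFirst_zero_one s

/-- In an almost-interval partition that becomes trivial after merging the blocks of `0` and `1`,
these two blocks are equal, or one of them is a singleton. -/
theorem IsAlmostInterval.zero_one_or_isSingletonBlock {n : ℕ} {s : Setoid (Fin (n + 3))}
    (hs : IsAlmostInterval s) (h : ∀ v, s v 0 ∨ s v 1) :
    s 0 1 ∨ IsSingletonBlock 0 s ∨ IsSingletonBlock 1 s := by
  rw [isAlmostInterval_iff] at hs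
  by_contra! hcon
  obtain ⟨h01, h0, h1⟩ := hcon
  simp only [IsSingletonBlock, not_forall] at h0 h1
  obtain ⟨v, hv, hv0⟩ := h0
  obtain ⟨w, hw, hw1⟩ := h1
  refine h01 (hs 0 1 v (by simp) ?_ hv ⟨w, hw1, hw⟩)
  rcases (Fin.one_le_of_ne_zero hv0).eq_or_lt with h | h
  · exact absurd (h ▸ hv) h01
  · exact h

theorem eq_insertSingletonEmbedding_top {n : ℕ} {r : Fin (n + 2)} (p : Fin (n + 2))
    {x : {s : Setoid (Fin (n + 2)) // IsAlmostInterval s}}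
    {t : {s : Setoid (Fin (n + 1)) // IsAlmostInterval s}} (ht : ∀ y, y ≤ t)
    (hx : IsSingletonBlock r x.1) (h : ∀ v, v ≠ r → x.1 v p) :
    x = insertSingletonEmbedding r t := by
  obtain ⟨q, rfl⟩ := exists_insertSingletonEmbedding_eq r x hx
  congr 1
  refine le_antisymm (ht q) fun i j _ => ?_
  refine (insertSingleton_succAbove r q.1 i j).1 ?_
  exact Setoid.trans' _ (h _ (Fin.succAbove_ne r i))
    (Setoid.symm' _ (h _ (Fin.succAbove_ne r j)))

theorem isAlmostInterval_top (n : ℕ) : IsAlmostInterval (⊤ : Setoid (Fin n)) :=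
  (isAlmostInterval_iff _).2 fun _ _ _ _ _ _ _ => trivial

theorem isAlmostInterval_bot (n : ℕ) : IsAlmostInterval (⊥ : Setoid (Fin n)) :=
  (isAlmostInterval_iff _).2 fun _ _ _ hab hbc hac _ => absurd hac (hab.trans hbc).ne

/-- The partitions whose join with the pair block `{0, 1}` is the maximum. -/
theorem filter_mergeFirst_eq_top {n : ℕ} {t : {s : Setoid (Fin (n + 3)) // IsAlmostInterval s}}
    {t' : {s : Setoid (Fin (n + 2)) // IsAlmostInterval s}} (ht : ∀ y, y ≤ t)
    (ht' : ∀ y, y ≤ t') :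
    Finset.univ.filter (fun x : {s : Setoid (Fin (n + 3)) // IsAlmostInterval s} =>
        (⟨mergeFirst x.1, x.2.mergeFirst⟩ : {s // IsAlmostInterval s}) = t) =
      {t, insertSingletonEmbedding 0 t', insertSingletonEmbedding 1 t'} := by
  have htt : ∀ u v, t.1 u v :=
    fun u v => ht ⟨⊤, isAlmostInterval_top _⟩ (trivial : (⊤ : Setoid _) u v)
  have htt' : ∀ u v, t'.1 u v :=
    fun u v => ht' ⟨⊤, isAlmostInterval_top _⟩ (trivial : (⊤ : Setoid _) u v)
  ext x
  simp only [Finset.mem_filter, Finset.mem_univ, true_and, Finset.mem_insert,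
    Finset.mem_singleton]
  constructor
  · intro hx
    have hx : ∀ u v, mergeFirst x.1 u v := fun u v => by
      have := htt u v
      rwa [← hx] at this
    have h : ∀ v, x.1 v 0 ∨ x.1 v 1 := fun v => (hx v 0).elim Or.inl And.left
    rcases x.2.zero_one_or_isSingletonBlock h with h01 | h0 | h1
    · refine Or.inl (le_antisymm (ht x) fun u v _ => ?_)
      exact mergeFirst_le le_rfl h01 (hx u v)
    · refine Or.inr (Or.inl (eq_insertSingletonEmbedding_top 1 ht' h0 fun v hv => ?_))
      exact (h v).resolve_left fun h => hv (h0 v (x.1.symm h))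
    · refine Or.inr (Or.inr (eq_insertSingletonEmbedding_top 0 ht' h1 fun v hv => ?_))
      exact (h v).resolve_right fun h => hv (h1 v (x.1.symm h))
  · intro hx
    refine le_antisymm (ht _) fun u v _ => ?_
    have key : ∀ r p : Fin (n + 3), p ≠ r → ∀ w, w ≠ r →
        (insertSingletonEmbedding r t').1 w p := by
      intro r p hp w hw
      obtain ⟨i, rfl⟩ := Fin.exists_succAbove_eq hw
      obtain ⟨j, rfl⟩ := Fin.exists_succAbove_eq hp
      exact (insertSingleton_succAbove r t'.1 i j).2 (htt' i j)
    have h : ∀ w, x.1 w 0 ∨ x.1 w 1 := by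
      intro w
      rcases hx with rfl | rfl | rfl
      · exact Or.inl (htt w 0)
      · rcases eq_or_ne w 0 with rfl | hw
        · exact Or.inl (Setoid.refl' _ _)
        · exact Or.inr (key 0 1 (by simp) w hw)
      · rcases eq_or_ne w 1 with rfl | hw
        · exact Or.inr (Setoid.refl' _ _)
        · exact Or.inl (key 1 0 (by simp) w hw)
    exact Or.inr ⟨h u, h v⟩

theorem mobius_almostIntervalPartitions
    (μ : (n : ℕ) → {s : Setoid (Fin n) // IsAlmostInterval s} →
      {s : Setoid (Fin n) // IsAlmostInterval s} → ℤ)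
    (hμ : ∀ (n : ℕ) (a b : {s : Setoid (Fin n) // IsAlmostInterval s}), a ≤ b →
      (∑ z ∈ Finset.univ.filter (fun z => a ≤ z ∧ z ≤ b), μ n a z) = if a = b then 1 else 0)
    (bot top : (n : ℕ) → {s : Setoid (Fin n) // IsAlmostInterval s})
    (hbot : ∀ n x, bot n ≤ x) (htop : ∀ n x, x ≤ top n) :
    (∀ n : ℕ, 3 ≤ n →
      μ n (bot n) (top n) = -2 * μ (n - 1) (bot (n - 1)) (top (n - 1))) ∧
    (∀ n : ℕ, 2 ≤ n →
      μ n (bot n) (top n) = (-1) ^ (n - 1) * 2 ^ (n - 2)) := by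
  have hbotsum : ∀ (n : ℕ) (y : {s : Setoid (Fin n) // IsAlmostInterval s}),
      ∑ x ∈ Finset.univ.filter (fun x => x ≤ y), μ n (bot n) x = if bot n = y then 1 else 0 := by
    intro n y
    rw [← hμ n (bot n) y (hbot n y)]
    exact Finset.sum_congr (by simp [hbot]) fun _ _ => rfl
  have hbotr : ∀ (n : ℕ) (u v : Fin n), (bot n).1 u v → u = v :=
    fun n u v h => hbot n ⟨⊥, isAlmostInterval_bot n⟩ h
  have htopr : ∀ (n : ℕ) (u v : Fin n), (top n).1 u v :=
    fun n u v => htop n ⟨⊤, isAlmostInterval_top n⟩ (trivial : (⊤ : Setoid _) u v)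
  have hinsert : ∀ (n : ℕ) (r : Fin (n + 1)) (q : {s : Setoid (Fin n) // IsAlmostInterval s}),
      μ (n + 1) (bot (n + 1)) (insertSingletonEmbedding r q) = μ n (bot n) q := by
    intro n r q
    refine eq_of_sum_le_eq (insertSingletonEmbedding r)
      (fun x q hx => exists_insertSingletonEmbedding_eq r x (isSingletonBlock_of_le hx))
      (μ (n + 1) (bot (n + 1))) (μ n (bot n)) (fun q => ?_) q
    obtain ⟨b, hb⟩ := exists_insertSingletonEmbedding_eq r (bot (n + 1))
      (isSingletonBlock_of_le (hbot (n + 1) (insertSingletonEmbedding r (bot n))))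
    have hb' : b = bot n := le_antisymm
      ((insertSingletonEmbedding r).le_iff_le.1 (hb ▸ hbot _ _)) (hbot n b)
    rw [hbotsum, hbotsum, ← hb, hb']
    simp only [EmbeddingLike.apply_eq_iff_eq]
  have hrec : ∀ m : ℕ, μ (m + 3) (bot (m + 3)) (top (m + 3)) =
      -2 * μ (m + 2) (bot (m + 2)) (top (m + 2)) := by
    intro m
    have h := sum_fiber_join_eq_zero (μ (m + 3) (bot (m + 3)))
      (fun x => ⟨mergeFirst x.1, x.2.mergeFirst⟩)
      ⟨mergeFirst (bot (m + 3)).1, (bot (m + 3)).2.mergeFirst⟩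
      (fun x => mergeFirst_le ((hbot _ x).trans (le_mergeFirst x.1)) (mergeFirst_zero_one x.1))
      (fun x y hy => ⟨fun h => (le_mergeFirst x.1).trans h,
        fun h => mergeFirst_le h (hy (mergeFirst_zero_one _))⟩)
      (fun y hy => by
        rw [hbotsum, if_neg]
        rintro rfl
        exact absurd (hbotr _ _ _ (hy (mergeFirst_zero_one _))) (by simp))
      (top (m + 3)) (htop _ _)
    have h0 : ∀ r : Fin (m + 3), ∀ v, v ≠ r →
        ¬ (insertSingletonEmbedding r (top (m + 2))).1 r v :=
      fun r v hv h => hv ((insertSingleton_self r _ v).1 h)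
    have hne : ∀ r : Fin (m + 3), ∀ v, v ≠ r →
        top (m + 3) ≠ insertSingletonEmbedding r (top (m + 2)) :=
      fun r v hv h => h0 r v hv (h ▸ htopr _ r v)
    have hne01 : insertSingletonEmbedding (0 : Fin (m + 3)) (top (m + 2)) ≠
        insertSingletonEmbedding 1 (top (m + 2)) := by
      intro h
      refine h0 0 (Fin.succAbove 1 1) (Fin.succAbove_ne_zero (by simp) (by simp)) ?_
      rw [h]
      exact (insertSingleton_succAbove 1 (top (m + 2)).1 0 1).2 (htopr _ 0 1)
    have h3 : ∑ x ∈ {top (m + 3), insertSingletonEmbedding 0 (top (m + 2)),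
        insertSingletonEmbedding 1 (top (m + 2))}, μ (m + 3) (bot (m + 3)) x = 0 := by
      rw [← filter_mergeFirst_eq_top (htop (m + 3)) (htop (m + 2))]
      convert h
    rw [Finset.sum_insert, Finset.sum_pair hne01, hinsert, hinsert] at h3
    · linarith
    · simp only [Finset.mem_insert, Finset.mem_singleton, not_or]
      exact ⟨hne 0 1 (by simp), hne 1 0 (by simp)⟩
  have htwo : μ 2 (bot 2) (top 2) = -1 := by
    have hne : bot 2 ≠ top 2 := fun h => absurd (hbotr 2 0 1 (h ▸ htopr 2 0 1)) (by simp)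
    have huniv : ∀ x, x = bot 2 ∨ x = top 2 := by
      intro x
      by_cases h : x.1 0 1
      · refine Or.inr (le_antisymm (htop 2 x) fun u v _ => ?_)
        have h' := x.1.symm h
        fin_cases u <;> fin_cases v <;> first | exact x.1.refl _ | exact h | exact h'
      · refine Or.inl (le_antisymm (fun u v huv => ?_) (hbot 2 x))
        have h' : ¬ x.1 1 0 := fun h' => h (x.1.symm h')
        fin_cases u <;> fin_cases v <;>
          first | exact (bot 2).1.refl _ | exact absurd huv h | exact absurd huv h'
    have hb := hbotsum 2 (bot 2)
    have ht := hbotsum 2 (top 2)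
    rw [show Finset.univ.filter (fun x => x ≤ bot 2) = {bot 2} by
      ext x; simpa using ⟨fun h => le_antisymm h (hbot 2 x), fun h => h.le⟩,
      Finset.sum_singleton, if_pos rfl] at hb
    rw [show Finset.univ.filter (fun x => x ≤ top 2) = {bot 2, top 2} by
      ext x; simpa [htop] using huniv x, Finset.sum_pair hne, if_neg hne] at ht
    linarith
  refine ⟨fun n hn => ?_, fun n hn => ?_⟩
  · obtain ⟨m, rfl⟩ := Nat.exists_eq_add_of_le' hn
    exact hrec m
  · induction n, hn using Nat.le_induction with
    | base => simpa using htwo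
    | succ n hn ih =>
      obtain ⟨m, rfl⟩ := Nat.exists_eq_add_of_le' hn
      rw [show m + 2 + 1 = m + 3 from rfl, hrec, ih]
      simp only [Nat.add_sub_cancel, show m + 3 - 1 = m + 2 from rfl,
        show m + 3 - 2 = m + 1 from rfl, show m + 2 - 1 = m + 1 from rfl]
      ring
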